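/- Let R = ℂ[x_{ijkl} : i, j, k, l ∈ {1,2}] and let G = SL_2(ℂ) × SL_2(ℂ) × SL_2(ℂ) × SL_2(ℂ) act on R by ℂ-algebra automorphisms determined by the linear substitution (g_1,g_2,g_3,g_4)·x_{ijkl} = Σ_{i',j',k',l'} (g_1)_{i'i}(g_2)_{j'j}(g_3)_{k'k}(g_4)_{l'l} x_{i'j'k'l'}. For every natural number d, the ℂ-vector space of polynomials in R that are homogeneous of degree d and fixed by every element of G has dimension equal to the number of quadruples (a,b,c,e) of natural numbers with 2a + 4b + 4c + 6e = d. (By Kac's theorem the invariant algebra is free on generators of degrees 2, 4, 4, 6; equivalently, the generating series of the quadruple rectangular Kronecker coefficients g(n^2,n^2,n^2,n^2) is Σ_n g(n^2,n^2,n^2,n^2) q^n = 1/((1−q)(1−q^2)^2(1−q^3)), the case of the affine Dynkin diagram D̂_4.) -/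

import Mathlib

noncomputable section

/-- The action of `(g₁, g₂, g₃, g₄) ∈ SL_{n₁}(ℂ) × SL_{n₂}(ℂ) × SL_{n₃}(ℂ) × SL_{n₄}(ℂ)`
on the polynomial ring `ℂ[x_v : v ∈ Fin n₁ × Fin n₂ × Fin n₃ × Fin n₄]` by the linear
substitution
`x_{ijkl} ↦ ∑_{i',j',k',l'} (g₁)_{i'i} (g₂)_{j'j} (g₃)_{k'k} (g₄)_{l'l} x_{i'j'k'l'}`. -/
def act4 (n₁ n₂ n₃ n₄ : ℕ)
    (g : Matrix.SpecialLinearGroup (Fin n₁) ℂ × Matrix.SpecialLinearGroup (Fin n₂) ℂ ×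
      Matrix.SpecialLinearGroup (Fin n₃) ℂ × Matrix.SpecialLinearGroup (Fin n₄) ℂ) :
    MvPolynomial (Fin n₁ × Fin n₂ × Fin n₃ × Fin n₄) ℂ →ₐ[ℂ]
      MvPolynomial (Fin n₁ × Fin n₂ × Fin n₃ × Fin n₄) ℂ :=
  MvPolynomial.aeval fun v : Fin n₁ × Fin n₂ × Fin n₃ × Fin n₄ =>
    ∑ w : Fin n₁ × Fin n₂ × Fin n₃ × Fin n₄,
      (g.1.val w.1 v.1 * g.2.1.val w.2.1 v.2.1 * g.2.2.1.val w.2.2.1 v.2.2.1 *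
          g.2.2.2.val w.2.2.2 v.2.2.2) •
        (MvPolynomial.X w : MvPolynomial (Fin n₁ × Fin n₂ × Fin n₃ × Fin n₄) ℂ)

/-- The space of polynomials homogeneous of degree `d` fixed by every element of
`SL_{n₁}(ℂ) × SL_{n₂}(ℂ) × SL_{n₃}(ℂ) × SL_{n₄}(ℂ)`. -/
def invSpace4 (n₁ n₂ n₃ n₄ d : ℕ) :
    Submodule ℂ (MvPolynomial (Fin n₁ × Fin n₂ × Fin n₃ × Fin n₄) ℂ) :=
  MvPolynomial.homogeneousSubmodule (Fin n₁ × Fin n₂ × Fin n₃ × Fin n₄) ℂ d ⊓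
    ⨅ g : Matrix.SpecialLinearGroup (Fin n₁) ℂ × Matrix.SpecialLinearGroup (Fin n₂) ℂ ×
        Matrix.SpecialLinearGroup (Fin n₃) ℂ × Matrix.SpecialLinearGroup (Fin n₄) ℂ,
      LinearMap.eqLocus (act4 n₁ n₂ n₃ n₄ g).toLinearMap LinearMap.id

open MvPolynomial
open scoped Kronecker

/-- The index set of the coordinates of `(ℂ²)^{⊗4}`. -/
abbrev QubitIdx : Type := Fin 2 × Fin 2 × Fin 2 × Fin 2

/-- The linear substitution by four matrices, acting on points. -/
def moveVec (A B C D : Matrix (Fin 2) (Fin 2) ℂ) (x : QubitIdx → ℂ) : QubitIdx → ℂ :=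
  fun v => ∑ w : QubitIdx, A w.1 v.1 * B w.2.1 v.2.1 * C w.2.2.1 v.2.2.1 * D w.2.2.2 v.2.2.2 * x w

/-- Invariance under the whole group, with no homogeneity condition. -/
def IsSLInvariant (f : MvPolynomial QubitIdx ℂ) : Prop :=
  ∀ g, act4 2 2 2 2 g f = f

lemma eval_act4 (g : Matrix.SpecialLinearGroup (Fin 2) ℂ × Matrix.SpecialLinearGroup (Fin 2) ℂ ×
      Matrix.SpecialLinearGroup (Fin 2) ℂ × Matrix.SpecialLinearGroup (Fin 2) ℂ)
    (f : MvPolynomial QubitIdx ℂ) (x : QubitIdx → ℂ) :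
    eval x (act4 2 2 2 2 g f) = eval (moveVec g.1.val g.2.1.val g.2.2.1.val g.2.2.2.val x) f := by
  have h : (aeval x).comp (act4 2 2 2 2 g) =
      aeval (moveVec g.1.val g.2.1.val g.2.2.1.val g.2.2.2.val x) := by
    ext v
    simp [act4, moveVec]
  have := DFunLike.congr_fun h f
  simpa [aeval_eq_eval] using this

lemma isSLInvariant_iff {f : MvPolynomial QubitIdx ℂ} :
    IsSLInvariant f ↔ ∀ A B C D : Matrix (Fin 2) (Fin 2) ℂ,
      A.det = 1 → B.det = 1 → C.det = 1 → D.det = 1 →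
        ∀ x, eval (moveVec A B C D x) f = eval x f := by
  constructor
  · intro h A B C D hA hB hC hD x
    have := eval_act4 (⟨A, hA⟩, ⟨B, hB⟩, ⟨C, hC⟩, ⟨D, hD⟩) f x
    rw [h] at this
    exact this.symm
  · intro h g
    refine MvPolynomial.funext fun x => ?_
    rw [eval_act4]
    exact h _ _ _ _ g.1.2 g.2.1.2 g.2.2.1.2 g.2.2.2.2 x

/-! ### The generators -/

section Generators

variable {R S : Type*} [CommRing R] [CommRing S]

/-- The coordinates as a matrix: rows are the first two indices, columns the last two. -/
def stateMatrix (x : QubitIdx → R) : Matrix (Fin 2 × Fin 2) (Fin 2 × Fin 2) R :=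
  Matrix.of fun i j => x (i.1, i.2, j.1, j.2)

/-- The standard alternating form. -/
def altForm (R : Type*) [CommRing R] : Matrix (Fin 2) (Fin 2) R := !![0, 1; -1, 0]

/-- The symmetric form on `R² ⊗ R²`, the square of the alternating form. -/
def symForm (R : Type*) [CommRing R] : Matrix (Fin 2 × Fin 2) (Fin 2 × Fin 2) R :=
  altForm R ⊗ₖ altForm R

/-- The endomorphism `M E Mᵀ E` attached to the matrix `M` of coordinates. -/
def gramMatrix (x : QubitIdx → R) : Matrix (Fin 2 × Fin 2) (Fin 2 × Fin 2) R :=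
  stateMatrix x * symForm R * (stateMatrix x).transpose * symForm R

/-- The values of the four basic invariants. -/
def basicInv (x : QubitIdx → R) : Fin 4 → R :=
  ![-(gramMatrix x).charpoly.coeff 3, (gramMatrix x).charpoly.coeff 2,
    -(gramMatrix x).charpoly.coeff 1, (stateMatrix x).det]

lemma map_stateMatrix (φ : R →+* S) (x : QubitIdx → R) :
    φ.mapMatrix (stateMatrix x) = stateMatrix (φ ∘ x) := rfl

lemma map_symForm (φ : R →+* S) : φ.mapMatrix (symForm R) = symForm S := by
  ext ⟨a, b⟩ ⟨c, d⟩
  fin_cases a <;> fin_cases b <;> fin_cases c <;> fin_cases d <;>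
    simp [symForm, altForm]

lemma map_gramMatrix (φ : R →+* S) (x : QubitIdx → R) :
    φ.mapMatrix (gramMatrix x) = gramMatrix (φ ∘ x) := by
  have h : φ.mapMatrix (stateMatrix x).transpose = (stateMatrix (φ ∘ x)).transpose := rfl
  simp only [gramMatrix, map_mul, map_symForm, map_stateMatrix, h]

lemma map_basicInv (φ : R →+* S) (x : QubitIdx → R) (i : Fin 4) :
    φ (basicInv x i) = basicInv (φ ∘ x) i := by
  have h (n : ℕ) : φ ((gramMatrix x).charpoly.coeff n) = (gramMatrix (φ ∘ x)).charpoly.coeff n := by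
    rw [← map_gramMatrix, RingHom.mapMatrix_apply, Matrix.charpoly_map, Polynomial.coeff_map]
  have h' : φ (stateMatrix x).det = (stateMatrix (φ ∘ x)).det := by
    rw [RingHom.map_det, map_stateMatrix]
  fin_cases i <;> simp [basicInv, h, h']

lemma mul_altForm_mul_transpose (A : Matrix (Fin 2) (Fin 2) R) (hA : A.det = 1) :
    A * altForm R * A.transpose = altForm R := by
  rw [Matrix.det_fin_two] at hA
  ext i j
  fin_cases i <;> fin_cases j <;>
    simp [altForm, Matrix.mul_apply, Fin.sum_univ_two] <;> grind

lemma kronecker_mul_symForm_mul_transpose (A B : Matrix (Fin 2) (Fin 2) R)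
    (hA : A.det = 1) (hB : B.det = 1) :
    (A ⊗ₖ B) * symForm R * ((A ⊗ₖ B)).transpose = symForm R := by
  have ht : ((A ⊗ₖ B)).transpose = A.transpose ⊗ₖ B.transpose := rfl
  rw [ht, symForm, ← Matrix.mul_kronecker_mul, ← Matrix.mul_kronecker_mul,
    mul_altForm_mul_transpose A hA, mul_altForm_mul_transpose B hB]

lemma stateMatrix_moveVec (A B C D : Matrix (Fin 2) (Fin 2) ℂ) (x : QubitIdx → ℂ) :
    stateMatrix (moveVec A B C D x) =
      ((A ⊗ₖ B)).transpose * stateMatrix x * (C ⊗ₖ D) := by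
  ext ⟨a, b⟩ ⟨c, d⟩
  simp [stateMatrix, moveVec, Matrix.mul_apply, Fintype.sum_prod_type, Fin.sum_univ_two]
  ring

lemma basicInv_moveVec {A B C D : Matrix (Fin 2) (Fin 2) ℂ} (hA : A.det = 1) (hB : B.det = 1)
    (hC : C.det = 1) (hD : D.det = 1) (x : QubitIdx → ℂ) :
    basicInv (moveVec A B C D x) = basicInv x := by
  have hc : (gramMatrix (moveVec A B C D x)).charpoly = (gramMatrix x).charpoly := by
    set h := (A ⊗ₖ B) with hh
    set k := (C ⊗ₖ D) with hk
    have h1 := kronecker_mul_symForm_mul_transpose A B hA hB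
    have h2 := kronecker_mul_symForm_mul_transpose C D hC hD
    rw [← hh] at h1
    rw [← hk] at h2
    have e1 : gramMatrix (moveVec A B C D x) =
        h.transpose * (stateMatrix x * (k * symForm ℂ * k.transpose) *
          (stateMatrix x).transpose * h * symForm ℂ) := by
      simp only [gramMatrix, stateMatrix_moveVec, Matrix.transpose_mul, Matrix.transpose_transpose,
        Matrix.mul_assoc, ← hh, ← hk]
    have e2 : stateMatrix x * symForm ℂ * (stateMatrix x).transpose * h * symForm ℂ * h.transpose =
        stateMatrix x * symForm ℂ * (stateMatrix x).transpose * (h * symForm ℂ * h.transpose) := by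
      simp only [Matrix.mul_assoc]
    rw [e1, h2, Matrix.charpoly_mul_comm, e2, h1, gramMatrix]
  have hd : (stateMatrix (moveVec A B C D x)).det = (stateMatrix x).det := by
    rw [stateMatrix_moveVec, Matrix.det_mul, Matrix.det_mul, Matrix.det_transpose,
      Matrix.det_kronecker, Matrix.det_kronecker]
    simp [hA, hB, hC, hD]
  simp only [basicInv, hc, hd]

end Generators

/-- The algebra map sending four free variables to the basic invariants. -/
def invariantMap : MvPolynomial (Fin 4) ℂ →ₐ[ℂ] MvPolynomial QubitIdx ℂ :=
  aeval (basicInv (X : QubitIdx → MvPolynomial QubitIdx ℂ))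

lemma eval_invariantMap (q : MvPolynomial (Fin 4) ℂ) (x : QubitIdx → ℂ) :
    eval x (invariantMap q) = eval (basicInv x) q := by
  have h : (aeval x).comp invariantMap = aeval (basicInv x) := by
    ext i
    have := map_basicInv (eval x) (X : QubitIdx → MvPolynomial QubitIdx ℂ) i
    have hx : (eval x) ∘ (X : QubitIdx → MvPolynomial QubitIdx ℂ) = x := by
      funext v; simp
    rw [hx] at this
    simpa [invariantMap, aeval_eq_eval] using this
  simpa [aeval_eq_eval] using DFunLike.congr_fun h q

lemma isSLInvariant_invariantMap (q : MvPolynomial (Fin 4) ℂ) : IsSLInvariant (invariantMap q) := by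
  rw [isSLInvariant_iff]
  intro A B C D hA hB hC hD x
  rw [eval_invariantMap, eval_invariantMap, basicInv_moveVec hA hB hC hD]

/-! ### Restriction to the Cartan subspace -/

section Cartan

variable {R : Type*} [CommRing R] [Algebra ℂ R]

/-- The point of the Cartan subspace, spanned by the four sums of a basis tensor of even weight and
its complement, with coordinates `t` diagonalising the quadratic form. -/
def cartan (t : Fin 4 → R) : QubitIdx → R := fun v =>
  (![![![![(1 / 2 : ℂ) • (t 0 + t 1), 0], ![0, (1 / 2 : ℂ) • (t 0 - t 1)]],
      ![![0, (1 / 2 : ℂ) • (t 2 + t 3)], ![(1 / 2 : ℂ) • (t 2 - t 3), 0]]],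
    ![![![0, (1 / 2 : ℂ) • (t 2 - t 3)], ![(1 / 2 : ℂ) • (t 2 + t 3), 0]],
      ![![(1 / 2 : ℂ) • (t 0 - t 1), 0], ![0, (1 / 2 : ℂ) • (t 0 + t 1)]]]] :
    Fin 2 → Fin 2 → Fin 2 → Fin 2 → R) v.1 v.2.1 v.2.2.1 v.2.2.2

end Cartan

/-- The values of the generators of the invariants of the Weyl group of type `D₄`. -/
def weylInv {R : Type*} [CommRing R] (t : Fin 4 → R) : Fin 4 → R :=
  ![t 0 ^ 2 + t 1 ^ 2 + t 2 ^ 2 + t 3 ^ 2,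
    t 0 ^ 2 * t 1 ^ 2 + t 0 ^ 2 * t 2 ^ 2 + t 0 ^ 2 * t 3 ^ 2 + t 1 ^ 2 * t 2 ^ 2 +
      t 1 ^ 2 * t 3 ^ 2 + t 2 ^ 2 * t 3 ^ 2,
    t 0 ^ 2 * t 1 ^ 2 * t 2 ^ 2 + t 0 ^ 2 * t 1 ^ 2 * t 3 ^ 2 + t 0 ^ 2 * t 2 ^ 2 * t 3 ^ 2 +
      t 1 ^ 2 * t 2 ^ 2 * t 3 ^ 2,
    t 0 * t 1 * t 2 * t 3]

lemma det_nested_blocks {R : Type*} [CommRing R] (p q r s : R) :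
    (!![p, 0, 0, q; 0, r, s, 0; 0, s, r, 0; q, 0, 0, p] : Matrix (Fin 4) (Fin 4) R).det =
      (p ^ 2 - q ^ 2) * (r ^ 2 - s ^ 2) := by
  simp [Matrix.det_succ_row_zero, Fin.sum_univ_succ, Fin.succAbove]
  ring

lemma finProdFinEquiv_two_two_symm (k : Fin 4) : (finProdFinEquiv (m := 2) (n := 2)).symm k =
    ![((0 : Fin 2), (0 : Fin 2)), (0, 1), (1, 0), (1, 1)] k := by
  fin_cases k <;> rfl

lemma reindex_gramMatrix_cartan (t : Fin 4 → ℂ) :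
    Matrix.reindex finProdFinEquiv finProdFinEquiv (gramMatrix (cartan t)) =
      !![(t 0 ^ 2 + t 1 ^ 2) / 2, 0, 0, (t 0 ^ 2 - t 1 ^ 2) / 2;
        0, (t 2 ^ 2 + t 3 ^ 2) / 2, (t 2 ^ 2 - t 3 ^ 2) / 2, 0;
        0, (t 2 ^ 2 - t 3 ^ 2) / 2, (t 2 ^ 2 + t 3 ^ 2) / 2, 0;
        (t 0 ^ 2 - t 1 ^ 2) / 2, 0, 0, (t 0 ^ 2 + t 1 ^ 2) / 2] := by
  ext i j
  simp only [Matrix.reindex_apply, Matrix.submatrix_apply, finProdFinEquiv_two_two_symm]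
  fin_cases i <;> fin_cases j <;>
    simp [gramMatrix, stateMatrix, symForm, altForm, cartan, Matrix.mul_apply,
      Fintype.sum_prod_type, Fin.sum_univ_two] <;> ring

lemma charpoly_gramMatrix_cartan (t : Fin 4 → ℂ) :
    (gramMatrix (cartan t)).charpoly =
      Polynomial.X ^ 4 - Polynomial.C (weylInv t 0) * Polynomial.X ^ 3 +
        Polynomial.C (weylInv t 1) * Polynomial.X ^ 2 - Polynomial.C (weylInv t 2) * Polynomial.X +
        Polynomial.C (weylInv t 3 ^ 2) := by
  rw [← Matrix.charpoly_reindex finProdFinEquiv, reindex_gramMatrix_cartan]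
  refine Polynomial.funext fun z => ?_
  have hz : Matrix.scalar (Fin 4) z -
      !![(t 0 ^ 2 + t 1 ^ 2) / 2, 0, 0, (t 0 ^ 2 - t 1 ^ 2) / 2;
        0, (t 2 ^ 2 + t 3 ^ 2) / 2, (t 2 ^ 2 - t 3 ^ 2) / 2, 0;
        0, (t 2 ^ 2 - t 3 ^ 2) / 2, (t 2 ^ 2 + t 3 ^ 2) / 2, 0;
        (t 0 ^ 2 - t 1 ^ 2) / 2, 0, 0, (t 0 ^ 2 + t 1 ^ 2) / 2] =
      !![z - (t 0 ^ 2 + t 1 ^ 2) / 2, 0, 0, -((t 0 ^ 2 - t 1 ^ 2) / 2);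
        0, z - (t 2 ^ 2 + t 3 ^ 2) / 2, -((t 2 ^ 2 - t 3 ^ 2) / 2), 0;
        0, -((t 2 ^ 2 - t 3 ^ 2) / 2), z - (t 2 ^ 2 + t 3 ^ 2) / 2, 0;
        -((t 0 ^ 2 - t 1 ^ 2) / 2), 0, 0, z - (t 0 ^ 2 + t 1 ^ 2) / 2] := by
    ext i j
    fin_cases i <;> fin_cases j <;> simp
  rw [Matrix.eval_charpoly, hz, det_nested_blocks]
  simp [weylInv]
  ring

lemma det_stateMatrix_cartan (t : Fin 4 → ℂ) :
    (stateMatrix (cartan t)).det = weylInv t 3 := by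
  have hN : Matrix.reindex finProdFinEquiv finProdFinEquiv (stateMatrix (cartan t)) =
      !![(t 0 + t 1) / 2, 0, 0, (t 0 - t 1) / 2;
        0, (t 2 + t 3) / 2, (t 2 - t 3) / 2, 0;
        0, (t 2 - t 3) / 2, (t 2 + t 3) / 2, 0;
        (t 0 - t 1) / 2, 0, 0, (t 0 + t 1) / 2] := by
    ext i j
    simp only [Matrix.reindex_apply, Matrix.submatrix_apply, finProdFinEquiv_two_two_symm]
    fin_cases i <;> fin_cases j <;>
      simp [stateMatrix, cartan] <;> ring
  rw [← Matrix.det_reindex_self finProdFinEquiv, hN, det_nested_blocks]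
  simp [weylInv]
  ring

lemma basicInv_cartan (t : Fin 4 → ℂ) : basicInv (cartan t) = weylInv t := by
  funext i
  fin_cases i
  · simp [basicInv, charpoly_gramMatrix_cartan, Polynomial.coeff_C, -map_pow]
  · simp [basicInv, charpoly_gramMatrix_cartan, Polynomial.coeff_C, -map_pow]
  · simp [basicInv, charpoly_gramMatrix_cartan, Polynomial.coeff_C, -map_pow]
  · simp [basicInv, det_stateMatrix_cartan]

/-- Restriction of polynomials to the Cartan subspace. -/
def restrict : MvPolynomial QubitIdx ℂ →ₐ[ℂ] MvPolynomial (Fin 4) ℂ :=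
  aeval (cartan (X : Fin 4 → MvPolynomial (Fin 4) ℂ))

lemma eval_restrict (f : MvPolynomial QubitIdx ℂ) (t : Fin 4 → ℂ) :
    eval t (restrict f) = eval (cartan t) f := by
  have h : (aeval t).comp restrict = aeval (cartan t) := by
    ext ⟨a, b, c, d⟩
    fin_cases a <;> fin_cases b <;> fin_cases c <;> fin_cases d <;>
      simp [restrict, cartan, mul_add, mul_sub]
  simpa [aeval_eq_eval] using DFunLike.congr_fun h f

/-! ### The Weyl group -/

lemma exists_eighth_root : ∃ z w : ℂ, z * w = 1 ∧ z ^ 2 = -w ^ 2 := by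
  obtain ⟨z, hz⟩ := IsAlgClosed.exists_pow_nat_eq (k := ℂ) Complex.I (n := 2) (by norm_num)
  have hz0 : z ≠ 0 := by
    rintro rfl
    simp at hz
    exact Complex.I_ne_zero hz.symm
  refine ⟨z, z⁻¹, mul_inv_cancel₀ hz0, ?_⟩
  rw [inv_pow, hz]
  simp

/-- A diagonal element negating the second spanning vector of the Cartan subspace. -/
lemma moveVec_diag_cartan₁ {z w : ℂ} (h1 : z * w = 1) (h2 : z ^ 2 = -w ^ 2) (t : Fin 4 → ℂ) :
    moveVec !![z, 0; 0, w] !![z, 0; 0, w] !![w, 0; 0, z] !![w, 0; 0, z] (cartan t) =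
      cartan ![t 1, t 0, t 2, t 3] := by
  have h3 : z ^ 4 = -1 := by linear_combination z ^ 2 * h2 - (z * w + 1) * h1
  have h4 : w ^ 4 = -1 := by linear_combination w ^ 2 * h2 - (z * w + 1) * h1
  funext ⟨a, b, c, d⟩
  fin_cases a <;> fin_cases b <;> fin_cases c <;> fin_cases d <;>
    simp [moveVec, cartan, Fintype.sum_prod_type, Fin.sum_univ_two] <;> grind

/-- A diagonal element negating the last spanning vector of the Cartan subspace. -/
lemma moveVec_diag_cartan₃ {z w : ℂ} (h1 : z * w = 1) (h2 : z ^ 2 = -w ^ 2) (t : Fin 4 → ℂ) :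
    moveVec !![z, 0; 0, w] !![w, 0; 0, z] !![w, 0; 0, z] !![z, 0; 0, w] (cartan t) =
      cartan ![t 0, t 1, t 3, t 2] := by
  have h3 : z ^ 4 = -1 := by linear_combination z ^ 2 * h2 - (z * w + 1) * h1
  have h4 : w ^ 4 = -1 := by linear_combination w ^ 2 * h2 - (z * w + 1) * h1
  funext ⟨a, b, c, d⟩
  fin_cases a <;> fin_cases b <;> fin_cases c <;> fin_cases d <;>
    simp [moveVec, cartan, Fintype.sum_prod_type, Fin.sum_univ_two] <;> grind

/-- A diagonal element negating the first spanning vector of the Cartan subspace. -/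
lemma moveVec_diag_cartan₀ {z w : ℂ} (h1 : z * w = 1) (h2 : z ^ 2 = -w ^ 2) (t : Fin 4 → ℂ) :
    moveVec !![z, 0; 0, w] !![z, 0; 0, w] !![z, 0; 0, w] !![z, 0; 0, w] (cartan t) =
      cartan ![-t 1, -t 0, t 2, t 3] := by
  have h3 : z ^ 4 = -1 := by linear_combination z ^ 2 * h2 - (z * w + 1) * h1
  have h4 : w ^ 4 = -1 := by linear_combination w ^ 2 * h2 - (z * w + 1) * h1
  funext ⟨a, b, c, d⟩
  fin_cases a <;> fin_cases b <;> fin_cases c <;> fin_cases d <;>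
    simp [moveVec, cartan, Fintype.sum_prod_type, Fin.sum_univ_two] <;> grind

/-- The Hadamard matrix, normalised to determinant one, in every factor. -/
lemma moveVec_hadamard_cartan {r : ℂ} (hr : r ^ 2 = -1 / 2) (t : Fin 4 → ℂ) :
    moveVec !![r, r; r, -r] !![r, r; r, -r] !![r, r; r, -r] !![r, r; r, -r] (cartan t) =
      cartan ![t 0, t 2, t 1, t 3] := by
  have h4 : r * r * r * r = 1 / 4 := by linear_combination (r ^ 2 - 1 / 2) * hr
  funext ⟨a, b, c, d⟩
  fin_cases a <;> fin_cases b <;> fin_cases c <;> fin_cases d <;>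
    simp [moveVec, cartan, Fintype.sum_prod_type, Fin.sum_univ_two, h4] <;> ring

/-- The symmetries of the restriction of an invariant polynomial to the Cartan subspace. -/
lemma eval_restrict_symm {f : MvPolynomial QubitIdx ℂ} (hf : IsSLInvariant f) (t : Fin 4 → ℂ) :
    eval ![t 1, t 0, t 2, t 3] (restrict f) = eval t (restrict f) ∧
    eval ![t 0, t 2, t 1, t 3] (restrict f) = eval t (restrict f) ∧
    eval ![t 0, t 1, t 3, t 2] (restrict f) = eval t (restrict f) ∧
    eval ![-t 1, -t 0, t 2, t 3] (restrict f) = eval t (restrict f) := by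
  obtain ⟨z, w, h1, h2⟩ := exists_eighth_root
  obtain ⟨r, hr⟩ := IsAlgClosed.exists_pow_nat_eq (k := ℂ) (-1 / 2) (n := 2) (by norm_num)
  have d1 : (!![z, 0; 0, w] : Matrix (Fin 2) (Fin 2) ℂ).det = 1 := by simp [h1]
  have d2 : (!![w, 0; 0, z] : Matrix (Fin 2) (Fin 2) ℂ).det = 1 := by simp [mul_comm w, h1]
  have d3 : (!![r, r; r, -r] : Matrix (Fin 2) (Fin 2) ℂ).det = 1 := by
    rw [Matrix.det_fin_two_of]
    linear_combination -2 * hr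
  rw [isSLInvariant_iff] at hf
  simp only [eval_restrict, ← moveVec_diag_cartan₁ h1 h2, ← moveVec_diag_cartan₃ h1 h2,
    ← moveVec_diag_cartan₀ h1 h2, ← moveVec_hadamard_cartan hr]
  exact ⟨hf _ _ _ _ d1 d1 d2 d2 _, hf _ _ _ _ d3 d3 d3 d3 _, hf _ _ _ _ d1 d2 d2 d1 _,
    hf _ _ _ _ d1 d1 d1 d1 _⟩

/-! ### Invariants of the Weyl group of type `D₄` -/

section SignChanges

variable {σ : Type*} [Fintype σ]

lemma coeff_aeval_smul_X (s : σ → ℂ) (P : MvPolynomial σ ℂ) (m : σ →₀ ℕ) :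
    coeff m (aeval (fun i => C (s i) * X i : σ → MvPolynomial σ ℂ) P) =
      (∏ i, s i ^ m i) * coeff m P := by
  classical
  induction P using MvPolynomial.induction_on' with
  | monomial d c =>
    have h : aeval (fun i => C (s i) * X i : σ → MvPolynomial σ ℂ) (monomial d c) =
        monomial d ((∏ i, s i ^ d i) * c) := by
      rw [aeval_monomial, Finsupp.prod_fintype _ _ (by simp)]
      simp only [mul_pow, Finset.prod_mul_distrib]
      rw [monomial_eq, Finsupp.prod_fintype _ _ (by simp)]
      simp only [algebraMap_eq, map_mul, map_prod, map_pow]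
      ring
    rw [h, coeff_monomial, coeff_monomial]
    split_ifs with hd
    · rw [hd]
    · simp
  | add p q hp hq => rw [map_add, coeff_add, hp, hq, coeff_add, mul_add]

/-- A monomial of a polynomial fixed by a change of signs has an even exponent in the variables
whose sign changes. -/
lemma prod_pow_eq_one_of_mem_support {s : σ → ℂ} {P : MvPolynomial σ ℂ}
    (hP : ∀ t, eval (fun i => s i * t i) P = eval t P) {m : σ →₀ ℕ} (hm : m ∈ P.support) :
    ∏ i, s i ^ m i = 1 := by
  have h : aeval (fun i => C (s i) * X i : σ → MvPolynomial σ ℂ) P = P := by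
    refine MvPolynomial.funext fun t => ?_
    rw [← hP t]
    have : (aeval t).comp (aeval (fun i => C (s i) * X i : σ → MvPolynomial σ ℂ)) =
        aeval (fun i => s i * t i) := by
      ext i; simp
    simpa [aeval_eq_eval] using DFunLike.congr_fun this P
  have h2 := coeff_aeval_smul_X s P m
  rw [h] at h2
  have h0 : coeff m P ≠ 0 := mem_support_iff.1 hm
  exact mul_right_cancel₀ h0 (by rw [← h2, one_mul])

end SignChanges

/-- The algebra map sending four free variables to the basic invariants of the Weyl group. -/
def weylMap : MvPolynomial (Fin 4) ℂ →ₐ[ℂ] MvPolynomial (Fin 4) ℂ :=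
  aeval (weylInv (X : Fin 4 → MvPolynomial (Fin 4) ℂ))

lemma eval_weylMap (q : MvPolynomial (Fin 4) ℂ) (t : Fin 4 → ℂ) :
    eval t (weylMap q) = eval (weylInv t) q := by
  have h : (aeval t).comp weylMap = aeval (weylInv t) := by
    ext i
    fin_cases i <;> simp [weylMap, weylInv]
  simpa [aeval_eq_eval] using DFunLike.congr_fun h q

lemma weylInv_X_mem_range (i : Fin 4) :
    weylInv (X : Fin 4 → MvPolynomial (Fin 4) ℂ) i ∈ weylMap.range :=
  ⟨X i, by simp [weylMap]⟩

lemma expand_two_esymm_mem_range (i : Fin 4) :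
    expand 2 (esymm (Fin 4) ℂ (i + 1)) ∈ weylMap.range := by
  have h1 : Finset.powersetCard 1 (Finset.univ : Finset (Fin 4)) = {{0}, {1}, {2}, {3}} := by
    decide
  have h2 : Finset.powersetCard 2 (Finset.univ : Finset (Fin 4)) =
      {{0, 1}, {0, 2}, {0, 3}, {1, 2}, {1, 3}, {2, 3}} := by decide
  have h3 : Finset.powersetCard 3 (Finset.univ : Finset (Fin 4)) =
      {{0, 1, 2}, {0, 1, 3}, {0, 2, 3}, {1, 2, 3}} := by decide
  have h4 : Finset.powersetCard 4 (Finset.univ : Finset (Fin 4)) = {{0, 1, 2, 3}} := by decide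
  have e1 : expand 2 (esymm (Fin 4) ℂ 1) = weylInv (X : Fin 4 → MvPolynomial (Fin 4) ℂ) 0 := by
    simp [esymm, h1, weylInv]
    ring
  have e2 : expand 2 (esymm (Fin 4) ℂ 2) = weylInv (X : Fin 4 → MvPolynomial (Fin 4) ℂ) 1 := by
    rw [esymm, h2]
    repeat rw [Finset.sum_insert (by decide)]
    simp [weylInv]
    ring
  have e3 : expand 2 (esymm (Fin 4) ℂ 3) = weylInv (X : Fin 4 → MvPolynomial (Fin 4) ℂ) 2 := by
    rw [esymm, h3]
    repeat rw [Finset.sum_insert (by decide)]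
    simp [weylInv]
    ring
  have e4 : expand 2 (esymm (Fin 4) ℂ 4) =
      weylInv (X : Fin 4 → MvPolynomial (Fin 4) ℂ) 3 ^ 2 := by
    simp [esymm, h4, weylInv]
    ring
  fin_cases i
  · exact e1 ▸ weylInv_X_mem_range 0
  · exact e2 ▸ weylInv_X_mem_range 1
  · exact e3 ▸ weylInv_X_mem_range 2
  · exact e4 ▸ pow_mem (weylInv_X_mem_range 3) 2

lemma expand_two_mem_range {p : MvPolynomial (Fin 4) ℂ} (hp : p.IsSymmetric) :
    expand 2 p ∈ weylMap.range := by
  obtain ⟨q, hq⟩ := esymmAlgHom_surjective (σ := Fin 4) ℂ (n := 4) (by simp) ⟨p, hp⟩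
  have hq' : aeval (fun i : Fin 4 => esymm (Fin 4) ℂ (i + 1)) q = p := by
    rw [← esymmAlgHom_apply, hq]
  rw [← hq']
  clear hq hq'
  induction q using MvPolynomial.induction_on with
  | C a =>
    rw [aeval_C, algebraMap_eq, expand_C]
    exact weylMap.range.algebraMap_mem a
  | add a b ha hb =>
    rw [map_add, map_add]
    exact add_mem ha hb
  | mul_X a i ha =>
    rw [map_mul, map_mul, aeval_X]
    exact mul_mem ha (expand_two_esymm_mem_range i)

lemma rename_eq_self_of_adjacent {P : MvPolynomial (Fin 4) ℂ}
    (h₀₁ : ∀ t : Fin 4 → ℂ, eval ![t 1, t 0, t 2, t 3] P = eval t P)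
    (h₁₂ : ∀ t : Fin 4 → ℂ, eval ![t 0, t 2, t 1, t 3] P = eval t P)
    (h₂₃ : ∀ t : Fin 4 → ℂ, eval ![t 0, t 1, t 3, t 2] P = eval t P) : P.IsSymmetric := by
  intro σ
  have hσ : σ ∈ Submonoid.closure
      (Set.range fun i : Fin 3 => Equiv.swap i.castSucc i.succ) := by
    rw [Equiv.Perm.mclosure_swap_castSucc_succ]
    trivial
  induction hσ using Submonoid.closure_induction with
  | mem σ hσ =>
    obtain ⟨i, rfl⟩ := hσ
    refine MvPolynomial.funext fun t => ?_
    rw [eval_rename]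
    fin_cases i
    · rw [← h₀₁ t]
      congr 1
      congr 1
      funext j
      fin_cases j <;> rfl
    · rw [← h₁₂ t]
      congr 1
      congr 1
      funext j
      fin_cases j <;> rfl
    · rw [← h₂₃ t]
      congr 1
      congr 1
      funext j
      fin_cases j <;> rfl
  | one => simp
  | mul σ τ _ _ hσ hτ =>
    rw [Equiv.Perm.coe_mul, ← rename_rename, hτ, hσ]

lemma isSymmetric_sum_rename (p : MvPolynomial (Fin 4) ℂ) :
    (∑ σ : Equiv.Perm (Fin 4), rename σ p).IsSymmetric := by
  intro τ
  rw [map_sum]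
  refine Fintype.sum_equiv (Equiv.mulLeft τ) _ _ fun σ => ?_
  rw [rename_rename, Equiv.coe_mulLeft, Equiv.Perm.coe_mul]

lemma monomial_eq_prod_X_pow_mul_expand {m m' : Fin 4 →₀ ℕ} {k : ℕ} (c : ℂ)
    (h : ∀ i, m i = k + 2 * m' i) :
    monomial m c = (∏ i, X i) ^ k * expand 2 (monomial m' c) := by
  refine MvPolynomial.funext fun t => ?_
  rw [map_mul, map_pow, map_prod, eval_expand, eval_monomial, eval_monomial,
    Finsupp.prod_fintype _ _ (fun i => pow_zero _), Finsupp.prod_fintype _ _ (fun i => pow_zero _)]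
  simp only [eval_X, h, Fin.prod_univ_four, Pi.pow_apply]
  ring

/-- A symmetrised monomial with all exponents of the same parity is a polynomial in the basic
invariants of the Weyl group. -/
lemma sum_rename_monomial_mem_range {m : Fin 4 →₀ ℕ} (c : ℂ)
    (hm : ∀ i, m i % 2 = m 0 % 2) :
    ∑ σ : Equiv.Perm (Fin 4), rename σ (monomial m c) ∈ weylMap.range := by
  set τ : MvPolynomial (Fin 4) ℂ := ∏ i, X i with hτ
  have hτ' : τ ∈ weylMap.range := by
    have : τ = weylInv (X : Fin 4 → MvPolynomial (Fin 4) ℂ) 3 := by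
      simp [hτ, Fin.prod_univ_four, weylInv]
    rw [this]
    exact weylInv_X_mem_range 3
  have hren (σ : Equiv.Perm (Fin 4)) : rename σ τ = τ := by
    rw [hτ, map_prod]
    simp only [rename_X]
    exact Equiv.prod_comp σ (fun i => (X i : MvPolynomial (Fin 4) ℂ))
  let m' : Fin 4 →₀ ℕ := Finsupp.equivFunOnFinite.symm fun i => m i / 2
  have hmon : monomial m c = τ ^ (m 0 % 2) * expand 2 (monomial m' c) :=
    monomial_eq_prod_X_pow_mul_expand c fun i => by
      rw [← hm i]
      exact (Nat.mod_add_div _ _).symm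
  have hsum : ∑ σ : Equiv.Perm (Fin 4), rename σ (monomial m c) =
      τ ^ (m 0 % 2) * expand 2 (∑ σ : Equiv.Perm (Fin 4), rename σ (monomial m' c)) := by
    rw [map_sum, Finset.mul_sum]
    refine Finset.sum_congr rfl fun σ _ => ?_
    rw [hmon, map_mul, map_pow, hren, rename_expand]
  rw [hsum]
  exact mul_mem (pow_mem hτ' _) (expand_two_mem_range (isSymmetric_sum_rename _))

lemma mem_range_weylMap {P : MvPolynomial (Fin 4) ℂ}
    (h₀₁ : ∀ t : Fin 4 → ℂ, eval ![t 1, t 0, t 2, t 3] P = eval t P)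
    (h₁₂ : ∀ t : Fin 4 → ℂ, eval ![t 0, t 2, t 1, t 3] P = eval t P)
    (h₂₃ : ∀ t : Fin 4 → ℂ, eval ![t 0, t 1, t 3, t 2] P = eval t P)
    (hneg : ∀ t : Fin 4 → ℂ, eval ![-t 1, -t 0, t 2, t 3] P = eval t P) :
    P ∈ weylMap.range := by
  have s₁ (t : Fin 4 → ℂ) : eval ![-t 0, -t 1, t 2, t 3] P = eval t P := by
    rw [← h₀₁, ← hneg t]
    rfl
  have s₂ (t : Fin 4 → ℂ) : eval ![-t 0, t 1, -t 2, t 3] P = eval t P := by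
    rw [← h₁₂, ← h₁₂ t, ← s₁ ![t 0, t 2, t 1, t 3]]
    rfl
  have s₃ (t : Fin 4 → ℂ) : eval ![-t 0, t 1, t 2, -t 3] P = eval t P := by
    rw [← h₂₃, ← h₂₃ t, ← s₂ ![t 0, t 1, t 3, t 2]]
    rfl
  have hparity {m : Fin 4 →₀ ℕ} (hm : m ∈ P.support) (i : Fin 4) : m i % 2 = m 0 % 2 := by
    have key (a b : ℕ) (hab : (-1 : ℂ) ^ a * (-1) ^ b = 1) : b % 2 = a % 2 := by
      rw [← pow_add, neg_one_pow_eq_one_iff_even (by norm_num)] at hab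
      rw [Nat.even_iff] at hab
      omega
    have k₁ := prod_pow_eq_one_of_mem_support (s := ![-1, -1, 1, 1]) (P := P)
      (fun t => by rw [← s₁ t]; congr 2; funext j; fin_cases j <;> simp) hm
    have k₂ := prod_pow_eq_one_of_mem_support (s := ![-1, 1, -1, 1]) (P := P)
      (fun t => by rw [← s₂ t]; congr 2; funext j; fin_cases j <;> simp) hm
    have k₃ := prod_pow_eq_one_of_mem_support (s := ![-1, 1, 1, -1]) (P := P)
      (fun t => by rw [← s₃ t]; congr 2; funext j; fin_cases j <;> simp) hm
    simp [Fin.prod_univ_four] at k₁ k₂ k₃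
    fin_cases i
    · rfl
    · exact key _ _ k₁
    · exact key _ _ k₂
    · exact key _ _ k₃
  have hsym := rename_eq_self_of_adjacent h₀₁ h₁₂ h₂₃
  have havg : (24 : ℂ) • P = ∑ m ∈ P.support,
      ∑ σ : Equiv.Perm (Fin 4), rename σ (monomial m (coeff m P)) := by
    rw [Finset.sum_comm]
    simp only [← map_sum, support_sum_monomial_coeff]
    simp only [hsym _, Finset.sum_const, Finset.card_univ, Fintype.card_perm, Fintype.card_fin]
    rw [← Nat.cast_smul_eq_nsmul ℂ]
    norm_num [Nat.factorial]
  have hmem : (24 : ℂ) • P ∈ weylMap.range := by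
    rw [havg]
    exact sum_mem fun m hm => sum_rename_monomial_mem_range _ (hparity hm)
  have := weylMap.range.smul_mem hmem (24 : ℂ)⁻¹
  rwa [inv_smul_smul₀ (by norm_num)] at this

/-! ### Surjectivity of the basic invariants on points -/

lemma exists_elementary_eq (a b c d : ℂ) : ∃ r₀ r₁ r₂ r₃ : ℂ,
    r₀ + r₁ + r₂ + r₃ = a ∧
    r₀ * r₁ + r₀ * r₂ + r₀ * r₃ + r₁ * r₂ + r₁ * r₃ + r₂ * r₃ = b ∧
    r₀ * r₁ * r₂ + r₀ * r₁ * r₃ + r₀ * r₂ * r₃ + r₁ * r₂ * r₃ = c ∧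
    r₀ * r₁ * r₂ * r₃ = d := by
  have h4 : ∃ r : ℂ, r ^ 4 - a * r ^ 3 + b * r ^ 2 - c * r + d = 0 := by
    obtain ⟨r, hr⟩ := IsAlgClosed.exists_root (Polynomial.X ^ 4 - Polynomial.C a * Polynomial.X ^ 3
      + Polynomial.C b * Polynomial.X ^ 2 - Polynomial.C c * Polynomial.X + Polynomial.C d) (by
        have : (Polynomial.X ^ 4 - Polynomial.C a * Polynomial.X ^ 3
          + Polynomial.C b * Polynomial.X ^ 2 - Polynomial.C c * Polynomial.X +
          Polynomial.C d).degree = 4 := by compute_degree!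
        rw [this]
        decide)
    exact ⟨r, by simpa [Polynomial.IsRoot] using hr⟩
  obtain ⟨r₀, h₀⟩ := h4
  set a' := a - r₀ with ha
  set b' := b - r₀ * a' with hb
  set c' := c - r₀ * b' with hc
  have h3 : ∃ r : ℂ, r ^ 3 - a' * r ^ 2 + b' * r - c' = 0 := by
    obtain ⟨r, hr⟩ := IsAlgClosed.exists_root (Polynomial.X ^ 3 - Polynomial.C a' * Polynomial.X ^ 2
      + Polynomial.C b' * Polynomial.X - Polynomial.C c') (by
        have : (Polynomial.X ^ 3 - Polynomial.C a' * Polynomial.X ^ 2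
          + Polynomial.C b' * Polynomial.X - Polynomial.C c').degree = 3 := by compute_degree!
        rw [this]
        decide)
    exact ⟨r, by simpa [Polynomial.IsRoot] using hr⟩
  obtain ⟨r₁, h₁⟩ := h3
  obtain ⟨s, hs⟩ := IsAlgClosed.exists_pow_nat_eq (k := ℂ)
    ((a' - r₁) ^ 2 - 4 * (b' - r₁ * (a' - r₁))) (n := 2) (by norm_num)
  refine ⟨r₀, r₁, (a' - r₁ + s) / 2, (a' - r₁ - s) / 2, ?_, ?_, ?_, ?_⟩
  · rw [ha]; ring
  · grind
  · grind
  · grind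

lemma weylInv_surjective (y : Fin 4 → ℂ) : ∃ t, weylInv t = y := by
  obtain ⟨r₀, r₁, r₂, r₃, e₁, e₂, e₃, e₄⟩ := exists_elementary_eq (y 0) (y 1) (y 2) (y 3 ^ 2)
  have hsq (r : ℂ) : ∃ s : ℂ, s ^ 2 = r := IsAlgClosed.exists_pow_nat_eq r (by norm_num)
  obtain ⟨t₀, rfl⟩ := hsq r₀
  obtain ⟨t₁, rfl⟩ := hsq r₁
  obtain ⟨t₂, rfl⟩ := hsq r₂
  obtain ⟨t₃, rfl⟩ := hsq r₃
  have h : (t₀ * t₁ * t₂ * t₃) ^ 2 = y 3 ^ 2 := by rw [← e₄]; ring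
  rcases sq_eq_sq_iff_eq_or_eq_neg.1 h with h | h
  · refine ⟨![t₀, t₁, t₂, t₃], ?_⟩
    funext i
    fin_cases i <;> simp [weylInv] <;> assumption
  · refine ⟨![-t₀, t₁, t₂, t₃], ?_⟩
    funext i
    fin_cases i <;> simp [weylInv]
    · assumption
    · assumption
    · assumption
    · linear_combination -h

lemma invariantMap_injective : Function.Injective invariantMap := by
  rw [injective_iff_map_eq_zero]
  intro q hq
  refine MvPolynomial.funext fun y => ?_
  obtain ⟨t, rfl⟩ := weylInv_surjective y
  rw [← basicInv_cartan, ← eval_invariantMap, hq, map_zero, map_zero]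

/-! ### Every point of the real form is conjugate to a point of the Cartan subspace -/

lemma moveVec_moveVec (A B C D A' B' C' D' : Matrix (Fin 2) (Fin 2) ℂ) (x : QubitIdx → ℂ) :
    moveVec A' B' C' D' (moveVec A B C D x) =
      moveVec (A * A') (B * B') (C * C') (D * D') x := by
  funext v
  simp only [moveVec, Finset.mul_sum, Matrix.mul_apply]
  rw [Finset.sum_comm]
  refine Finset.sum_congr rfl fun w _ => ?_
  simp only [Fintype.sum_prod_type, Fin.sum_univ_two]
  ring

/-- The complementary index. -/
def complIdx (v : QubitIdx) : QubitIdx := (v.1 + 1, v.2.1 + 1, v.2.2.1 + 1, v.2.2.2 + 1)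

/-- The sign of an index, by the parity of its weight. -/
def idxSign (v : QubitIdx) : ℂ :=
  (-1) ^ (v.1.val + v.2.1.val + v.2.2.1.val + v.2.2.2.val)

/-- The real form of `(ℂ²)^{⊗4}` preserved by `SU(2)⁴`. -/
def IsRealPoint (x : QubitIdx → ℂ) : Prop :=
  ∀ v, star (x v) = idxSign v * x (complIdx v)

/-- The elements of `SU(2)`, parametrised by the first row. -/
def suMatrix (p : ℂ × ℂ) : Matrix (Fin 2) (Fin 2) ℂ := !![p.1, p.2; -star p.2, star p.1]

/-- The unit sphere of `ℂ²`. -/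
def unitPairs : Set (ℂ × ℂ) := {p | Complex.normSq p.1 + Complex.normSq p.2 = 1}

lemma det_suMatrix {p : ℂ × ℂ} (hp : p ∈ unitPairs) : (suMatrix p).det = 1 := by
  have h : (Complex.normSq p.1 : ℂ) + Complex.normSq p.2 = 1 := by exact_mod_cast hp
  rw [Complex.normSq_eq_conj_mul_self, Complex.normSq_eq_conj_mul_self] at h
  rw [suMatrix, Matrix.det_fin_two_of, ← h]
  simp only [Complex.star_def]
  ring

lemma isCompact_unitPairs : IsCompact unitPairs := by
  refine Metric.isCompact_of_isClosed_isBounded ?_ ?_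
  · exact isClosed_eq (by fun_prop) continuous_const
  · refine (Metric.isBounded_closedBall (x := (0 : ℂ × ℂ)) (r := 1)).subset fun p hp => ?_
    have hp : Complex.normSq p.1 + Complex.normSq p.2 = 1 := hp
    rw [mem_closedBall_zero_iff, Prod.norm_def, max_le_iff]
    rw [Complex.normSq_eq_norm_sq, Complex.normSq_eq_norm_sq] at hp
    constructor <;> nlinarith [norm_nonneg p.1, norm_nonneg p.2, sq_nonneg ‖p.1‖, sq_nonneg ‖p.2‖]

lemma exists_suMatrix_mul {p q : ℂ × ℂ} (hp : p ∈ unitPairs) (hq : q ∈ unitPairs) :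
    ∃ r ∈ unitPairs, suMatrix p * suMatrix q = suMatrix r := by
  refine ⟨(p.1 * q.1 - p.2 * star q.2, p.1 * q.2 + p.2 * star q.1), ?_, ?_⟩
  · simp only [unitPairs, Set.mem_ofPred_eq, Complex.normSq_apply] at hp hq ⊢
    simp
    linear_combination (p.1.re * p.1.re + p.1.im * p.1.im + (p.2.re * p.2.re + p.2.im * p.2.im)) * hq
      + hp
  · ext i j
    fin_cases i <;> fin_cases j <;> simp [suMatrix, Matrix.mul_apply, Fin.sum_univ_two] <;> ring

lemma star_suMatrix (p : ℂ × ℂ) (i j : Fin 2) :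
    star (suMatrix p i j) = (-1) ^ (i.val + j.val) * suMatrix p (i + 1) (j + 1) := by
  fin_cases i <;> fin_cases j <;> simp [suMatrix]

lemma isRealPoint_moveVec {x : QubitIdx → ℂ} (hx : IsRealPoint x) (p q r s : ℂ × ℂ) :
    IsRealPoint (moveVec (suMatrix p) (suMatrix q) (suMatrix r) (suMatrix s) x) := by
  intro v
  let e : QubitIdx ≃ QubitIdx := ⟨complIdx, complIdx,
    fun v => by obtain ⟨a, b, c, d⟩ := v; revert a b c d; decide,
    fun v => by obtain ⟨a, b, c, d⟩ := v; revert a b c d; decide⟩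
  simp only [moveVec, star_sum, star_mul', hx _, star_suMatrix, Finset.mul_sum]
  refine Fintype.sum_equiv e _ _ fun w => ?_
  have hw : idxSign w * idxSign w = 1 := by
    rw [idxSign, ← mul_pow]; simp
  simp only [e, Equiv.coe_fn_mk, complIdx, idxSign, pow_add] at hw ⊢
  linear_combination ((-1) ^ v.1.val * (-1) ^ v.2.1.val * (-1) ^ v.2.2.1.val * (-1) ^ v.2.2.2.val *
    suMatrix p (w.1 + 1) (v.1 + 1) * suMatrix q (w.2.1 + 1) (v.2.1 + 1) *
    suMatrix r (w.2.2.1 + 1) (v.2.2.1 + 1) * suMatrix s (w.2.2.2 + 1) (v.2.2.2 + 1) *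
    x (w.1 + 1, w.2.1 + 1, w.2.2.1 + 1, w.2.2.2 + 1)) * hw

/-- The value at `x` of the real functional attached to a regular point of the Cartan subspace. -/
def height (x : QubitIdx → ℂ) : ℝ :=
  (x (0, 0, 0, 0)).re + (x (1, 1, 1, 1)).re + 2 * ((x (0, 0, 1, 1)).re + (x (1, 1, 0, 0)).re) +
    4 * ((x (0, 1, 0, 1)).re + (x (1, 0, 1, 0)).re) +
    8 * ((x (0, 1, 1, 0)).re + (x (1, 0, 0, 1)).re)

lemma eq_zero_of_forall_unit_le {a b : ℝ}
    (h : ∀ c s : ℝ, c ^ 2 + s ^ 2 = 1 → c * a + s * b ≤ a) : b = 0 := by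
  by_contra hb
  have hpos : 0 < a ^ 2 + b ^ 2 := by positivity
  set r := Real.sqrt (a ^ 2 + b ^ 2) with hr
  have hr0 : 0 < r := Real.sqrt_pos.2 hpos
  have hr2 : r ^ 2 = a ^ 2 + b ^ 2 := Real.sq_sqrt hpos.le
  have h1 := h (a / r) (b / r) (by field_simp; rw [hr2])
  have h2 : a / r * a + b / r * b = r := by field_simp; rw [hr2]
  rw [h2] at h1
  have : 0 < b ^ 2 := by positivity
  nlinarith

lemma height_add_smul (c s : ℝ) (x y : QubitIdx → ℂ) :
    height (fun v => c * x v + s * y v) = c * height x + s * height y := by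
  simp [height]
  ring

lemma suMatrix_one : suMatrix (1, 0) = 1 := by
  ext i j
  fin_cases i <;> fin_cases j <;> simp [suMatrix]

lemma suMatrix_combination (c s : ℝ) (p : ℂ × ℂ) (i j : Fin 2) :
    suMatrix (c + s * p.1, s * p.2) i j = c * suMatrix (1, 0) i j + s * suMatrix p i j := by
  fin_cases i <;> fin_cases j <;> simp [suMatrix]

lemma moveVec_suMatrix_one (x : QubitIdx → ℂ) :
    moveVec (suMatrix (1, 0)) (suMatrix (1, 0)) (suMatrix (1, 0)) (suMatrix (1, 0)) x = x := by
  funext ⟨a, b, c, d⟩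
  simp [moveVec, suMatrix_one, Fintype.sum_prod_type, Matrix.one_apply]

lemma combination_mem_unitPairs {c s : ℝ} (h : c ^ 2 + s ^ 2 = 1) {p : ℂ × ℂ}
    (hp : p ∈ unitPairs) (hp0 : p.1.re = 0) :
    ((c + s * p.1, s * p.2) : ℂ × ℂ) ∈ unitPairs := by
  simp only [unitPairs, Set.mem_ofPred_eq, Complex.normSq_apply] at hp ⊢
  simp [hp0] at hp ⊢
  linear_combination h + s ^ 2 * hp

lemma one_mem_unitPairs : ((1, 0) : ℂ × ℂ) ∈ unitPairs := by simp [unitPairs]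

/-- The first-order conditions at a maximum of the height along an orbit of `SU(2)⁴`. -/
lemma height_eq_zero_of_isMax {x : QubitIdx → ℂ}
    (hmax : ∀ p ∈ unitPairs, ∀ q ∈ unitPairs, ∀ r ∈ unitPairs, ∀ s ∈ unitPairs,
      height (moveVec (suMatrix p) (suMatrix q) (suMatrix r) (suMatrix s) x) ≤ height x)
    {p : ℂ × ℂ} (hp : p ∈ unitPairs) (hp0 : p.1.re = 0) :
    height (moveVec (suMatrix p) 1 1 1 x) = 0 ∧ height (moveVec 1 (suMatrix p) 1 1 x) = 0 ∧
    height (moveVec 1 1 (suMatrix p) 1 x) = 0 ∧ height (moveVec 1 1 1 (suMatrix p) x) = 0 := by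
  have h1 := one_mem_unitPairs
  simp only [← suMatrix_one]
  refine ⟨?_, ?_, ?_, ?_⟩ <;>
    refine eq_zero_of_forall_unit_le (a := height x) fun c s hcs => ?_ <;>
    have hm := combination_mem_unitPairs hcs hp hp0 <;>
    rw [← height_add_smul]
  · convert hmax _ hm _ h1 _ h1 _ h1 using 2
    funext v
    nth_rw 1 [← moveVec_suMatrix_one x]
    simp only [moveVec, suMatrix_combination c s, Finset.mul_sum, ← Finset.sum_add_distrib]
    exact Finset.sum_congr rfl fun w _ => by ring
  · convert hmax _ h1 _ hm _ h1 _ h1 using 2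
    funext v
    nth_rw 1 [← moveVec_suMatrix_one x]
    simp only [moveVec, suMatrix_combination c s, Finset.mul_sum, ← Finset.sum_add_distrib]
    exact Finset.sum_congr rfl fun w _ => by ring
  · convert hmax _ h1 _ h1 _ hm _ h1 using 2
    funext v
    nth_rw 1 [← moveVec_suMatrix_one x]
    simp only [moveVec, suMatrix_combination c s, Finset.mul_sum, ← Finset.sum_add_distrib]
    exact Finset.sum_congr rfl fun w _ => by ring
  · convert hmax _ h1 _ h1 _ h1 _ hm using 2
    funext v
    nth_rw 1 [← moveVec_suMatrix_one x]
    simp only [moveVec, suMatrix_combination c s, Finset.mul_sum, ← Finset.sum_add_distrib]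
    exact Finset.sum_congr rfl fun w _ => by ring

lemma moveVec_factor (A : Matrix (Fin 2) (Fin 2) ℂ) (x : QubitIdx → ℂ) (a b c d : Fin 2) :
    moveVec A 1 1 1 x (a, b, c, d) = A 0 a * x (0, b, c, d) + A 1 a * x (1, b, c, d) ∧
    moveVec 1 A 1 1 x (a, b, c, d) = A 0 b * x (a, 0, c, d) + A 1 b * x (a, 1, c, d) ∧
    moveVec 1 1 A 1 x (a, b, c, d) = A 0 c * x (a, b, 0, d) + A 1 c * x (a, b, 1, d) ∧
    moveVec 1 1 1 A x (a, b, c, d) = A 0 d * x (a, b, c, 0) + A 1 d * x (a, b, c, 1) := by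
  refine ⟨?_, ?_, ?_, ?_⟩ <;>
    simp [moveVec, Fintype.sum_prod_type, Matrix.one_apply, Fin.sum_univ_two]

lemma IsRealPoint.apply_one {x : QubitIdx → ℂ} (hx : IsRealPoint x) (b c d : Fin 2) :
    (x (1, b + 1, c + 1, d + 1)).re = (-1) ^ (b.val + c.val + d.val) * (x (0, b, c, d)).re ∧
    (x (1, b + 1, c + 1, d + 1)).im = -((-1) ^ (b.val + c.val + d.val) * (x (0, b, c, d)).im) := by
  have h := hx (0, b, c, d)
  rw [Complex.ext_iff] at h
  revert h
  fin_cases b <;> fin_cases c <;> fin_cases d <;>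
    simp [idxSign, complIdx, pow_succ] <;> intro h1 h2 <;> constructor <;> linarith

set_option maxHeartbeats 1000000 in
/-- A real point at which the height is critical along its orbit lies in the Cartan subspace. -/
lemma exists_eq_cartan_of_isMax {x : QubitIdx → ℂ} (hx : IsRealPoint x)
    (hmax : ∀ p ∈ unitPairs, ∀ q ∈ unitPairs, ∀ r ∈ unitPairs, ∀ s ∈ unitPairs,
      height (moveVec (suMatrix p) (suMatrix q) (suMatrix r) (suMatrix s) x) ≤ height x) :
    ∃ t : Fin 4 → ℂ, x = cartan t := by
  have h1 := height_eq_zero_of_isMax hmax (p := (Complex.I, 0)) (by simp [unitPairs]) (by simp)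
  have h2 := height_eq_zero_of_isMax hmax (p := (0, Complex.I)) (by simp [unitPairs]) (by simp)
  have h3 := height_eq_zero_of_isMax hmax (p := (0, 1)) (by simp [unitPairs]) (by simp)
  have r (b c d : Fin 2) := hx.apply_one b c d
  simp only [Fin.forall_fin_two] at r
  simp [height, moveVec_factor, suMatrix] at h1 h2 h3 r
  obtain ⟨⟨⟨⟨a1, b1⟩, a2, b2⟩, ⟨a3, b3⟩, a4, b4⟩, ⟨⟨a5, b5⟩, a6, b6⟩, ⟨a7, b7⟩, a8, b8⟩ := r
  simp only [b1, a2, b2, a3, b3, b4, a5, b5, b6, b7, a8, b8] at h1 h2 h3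
  obtain ⟨c1, c2, c3, c4⟩ := h1
  obtain ⟨d1, d2, d3, d4⟩ := h2
  obtain ⟨e1, e2, e3, e4⟩ := h3
  refine ⟨fun i => ((![(x (0,0,0,0)).re + (x (0,0,1,1)).re, (x (0,0,0,0)).re - (x (0,0,1,1)).re,
    (x (0,1,0,1)).re + (x (0,1,1,0)).re, (x (0,1,0,1)).re - (x (0,1,1,0)).re] i : ℝ) : ℂ), ?_⟩
  funext ⟨a, b, c, d⟩
  fin_cases a <;> fin_cases b <;> fin_cases c <;> fin_cases d <;>
    refine Complex.ext ?_ ?_ <;> simp [cartan] <;> linarith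

lemma continuous_height_moveVec (x : QubitIdx → ℂ) :
    Continuous fun P : (ℂ × ℂ) × (ℂ × ℂ) × (ℂ × ℂ) × (ℂ × ℂ) =>
      height (moveVec (suMatrix P.1) (suMatrix P.2.1) (suMatrix P.2.2.1) (suMatrix P.2.2.2) x) := by
  have h (i j : Fin 2) : Continuous fun p : ℂ × ℂ => suMatrix p i j := by
    fin_cases i <;> fin_cases j <;> simp [suMatrix] <;> fun_prop
  have h1 (i j : Fin 2) {f : (ℂ × ℂ) × (ℂ × ℂ) × (ℂ × ℂ) × (ℂ × ℂ) → ℂ × ℂ} (hf : Continuous f) :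
      Continuous fun P => suMatrix (f P) i j := (h i j).comp hf
  have hv (v : QubitIdx) : Continuous fun P : (ℂ × ℂ) × (ℂ × ℂ) × (ℂ × ℂ) × (ℂ × ℂ) =>
      (moveVec (suMatrix P.1) (suMatrix P.2.1) (suMatrix P.2.2.1) (suMatrix P.2.2.2) x v).re := by
    refine Complex.continuous_re.comp (continuous_finsetSum _ fun w _ => ?_)
    exact (((((h1 _ _ (by fun_prop)).mul (h1 _ _ (by fun_prop))).mul (h1 _ _ (by fun_prop))).mul
      (h1 _ _ (by fun_prop))).mul continuous_const)
  unfold height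
  fun_prop (disch := exact hv _)

/-- Every point of the real form is moved into the Cartan subspace by an element of `SU(2)⁴`. -/
lemma exists_moveVec_eq_cartan {x : QubitIdx → ℂ} (hx : IsRealPoint x) :
    ∃ A B C D : Matrix (Fin 2) (Fin 2) ℂ, A.det = 1 ∧ B.det = 1 ∧ C.det = 1 ∧ D.det = 1 ∧
      ∃ t, moveVec A B C D x = cartan t := by
  obtain ⟨⟨p, q, r, s⟩, ⟨hp, hq, hr, hs⟩, hmax⟩ :=
    (isCompact_unitPairs.prod (isCompact_unitPairs.prod
      (isCompact_unitPairs.prod isCompact_unitPairs))).exists_isMaxOn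
      ⟨((1, 0), (1, 0), (1, 0), (1, 0)), one_mem_unitPairs, one_mem_unitPairs, one_mem_unitPairs,
        one_mem_unitPairs⟩ (continuous_height_moveVec x).continuousOn
  refine ⟨_, _, _, _, det_suMatrix hp, det_suMatrix hq, det_suMatrix hr, det_suMatrix hs,
    exists_eq_cartan_of_isMax (isRealPoint_moveVec hx p q r s) ?_⟩
  intro p' hp' q' hq' r' hr' s' hs'
  obtain ⟨p₂, hp₂, ep⟩ := exists_suMatrix_mul hp hp'
  obtain ⟨q₂, hq₂, eq⟩ := exists_suMatrix_mul hq hq'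
  obtain ⟨r₂, hr₂, er⟩ := exists_suMatrix_mul hr hr'
  obtain ⟨s₂, hs₂, es⟩ := exists_suMatrix_mul hs hs'
  rw [moveVec_moveVec, ep, eq, er, es]
  exact hmax (a := (p₂, q₂, r₂, s₂)) ⟨hp₂, hq₂, hr₂, hs₂⟩

/-- The parametrisation of the real form by its real and imaginary parts, complexified. -/
def realFormParam {R : Type*} [CommRing R] [Algebra ℂ R] (u : QubitIdx → R) : QubitIdx → R :=
  fun v => if v.1 = 0 then u v + Complex.I • u (v.1 + 1, v.2)
    else idxSign v • (u (complIdx v) - Complex.I • u (v.1, (complIdx v).2))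

lemma isRealPoint_realFormParam (u : QubitIdx → ℝ) :
    IsRealPoint (realFormParam fun v => (u v : ℂ)) := by
  rintro ⟨a, b, c, d⟩
  fin_cases a <;> fin_cases b <;> fin_cases c <;> fin_cases d <;>
    simp [realFormParam, idxSign, complIdx] <;> ring

lemma realFormParam_surjective (x : QubitIdx → ℂ) : ∃ u, realFormParam u = x := by
  refine ⟨fun v => if v.1 = 0 then (x v + idxSign (complIdx v) * x (complIdx v)) / 2 else
    (x (0, v.2) - idxSign (complIdx (0, v.2)) * x (complIdx (0, v.2))) / (2 * Complex.I), ?_⟩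
  have hI : Complex.I ≠ 0 := Complex.I_ne_zero
  funext ⟨a, b, c, d⟩
  fin_cases a <;> fin_cases b <;> fin_cases c <;> fin_cases d <;>
    simp [realFormParam, idxSign, complIdx] <;> field_simp <;> ring

/-- A polynomial vanishing on the real form is zero. -/
lemma eq_zero_of_eval_isRealPoint {f : MvPolynomial QubitIdx ℂ}
    (h : ∀ x, IsRealPoint x → eval x f = 0) : f = 0 := by
  have he (u : QubitIdx → ℂ) :
      eval u (aeval (realFormParam (X : QubitIdx → MvPolynomial QubitIdx ℂ)) f) =
        eval (realFormParam u) f := by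
    have h2 : (aeval u).comp (aeval (realFormParam (X : QubitIdx → MvPolynomial QubitIdx ℂ))) =
        aeval (realFormParam u) := by
      ext v
      simp only [AlgHom.comp_apply, aeval_X, realFormParam]
      split_ifs <;> simp
    simpa [aeval_eq_eval] using DFunLike.congr_fun h2 f
  have h0 : aeval (realFormParam (X : QubitIdx → MvPolynomial QubitIdx ℂ)) f = 0 := by
    refine MvPolynomial.funext_set (fun _ => Set.range ((↑) : ℝ → ℂ))
      (fun _ => Set.infinite_range_of_injective Complex.ofReal_injective) fun u hu => ?_
    have hu' : ∀ v, ∃ y : ℝ, (y : ℂ) = u v := fun v => hu v (Set.mem_univ v)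
    choose y hy using hu'
    rw [he, map_zero, ← _root_.funext hy]
    exact h _ (isRealPoint_realFormParam y)
  refine MvPolynomial.funext fun x => ?_
  obtain ⟨u, rfl⟩ := realFormParam_surjective x
  rw [← he, h0, map_zero, map_zero]

lemma eq_zero_of_restrict_eq_zero {f : MvPolynomial QubitIdx ℂ} (hf : IsSLInvariant f)
    (h : restrict f = 0) : f = 0 := by
  refine eq_zero_of_eval_isRealPoint fun x hx => ?_
  obtain ⟨A, B, C, D, hA, hB, hC, hD, t, ht⟩ := exists_moveVec_eq_cartan hx
  rw [← isSLInvariant_iff.1 hf A B C D hA hB hC hD, ht, ← eval_restrict, h, map_zero]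

/-- The invariant algebra is generated by the four basic invariants. -/
lemma mem_range_invariantMap {f : MvPolynomial QubitIdx ℂ} (hf : IsSLInvariant f) :
    ∃ q, invariantMap q = f := by
  obtain ⟨q, hq⟩ : restrict f ∈ weylMap.range :=
    mem_range_weylMap (fun t => (eval_restrict_symm hf t).1)
      (fun t => (eval_restrict_symm hf t).2.1) (fun t => (eval_restrict_symm hf t).2.2.1)
      (fun t => (eval_restrict_symm hf t).2.2.2)
  refine ⟨q, sub_eq_zero.1 (eq_zero_of_restrict_eq_zero ?_ ?_)⟩
  · intro g
    rw [map_sub, hf, isSLInvariant_invariantMap]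
  · rw [map_sub, sub_eq_zero, ← hq]
    refine MvPolynomial.funext fun t => ?_
    rw [eval_restrict, eval_invariantMap, basicInv_cartan]
    exact (eval_weylMap q t).symm

/-! ### Degrees -/

/-- The degrees of the basic invariants. -/
def basicDegree : Fin 4 → ℕ := ![2, 4, 6, 4]

lemma isHomogeneous_gramMatrix (i j : Fin 2 × Fin 2) :
    (gramMatrix (X : QubitIdx → MvPolynomial QubitIdx ℂ) i j).IsHomogeneous 2 := by
  have hs (a b : Fin 2 × Fin 2) :
      (symForm (MvPolynomial QubitIdx ℂ) a b).IsHomogeneous 0 := by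
    obtain ⟨a, b⟩ := a
    obtain ⟨c, d⟩ := b
    rw [← map_symForm C]
    exact isHomogeneous_C _ _
  simp only [gramMatrix, Matrix.mul_apply, Finset.sum_mul]
  refine IsHomogeneous.sum _ _ _ fun a _ => IsHomogeneous.sum _ _ _ fun b _ =>
    IsHomogeneous.sum _ _ _ fun c _ => ?_
  exact ((((isHomogeneous_X _ _).mul (hs _ _)).mul (isHomogeneous_X _ _)).mul (hs _ _))

lemma isHomogeneous_coeff_charpoly_gramMatrix {i j : ℕ} (h : i + j = 4) :
    ((gramMatrix (X : QubitIdx → MvPolynomial QubitIdx ℂ)).charpoly.coeff i).IsHomogeneous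
      (2 * j) := by
  have h1 := Matrix.charpoly.univ_coeff_isHomogeneous ℂ (Fin 2 × Fin 2) i j (by simpa using h)
  have h2 := Matrix.charpoly.univ_coeff_eval₂Hom (Fin 2 × Fin 2)
    (C : ℂ →+* MvPolynomial QubitIdx ℂ)
    (Function.uncurry (gramMatrix (X : QubitIdx → MvPolynomial QubitIdx ℂ))) i
  have h3 : Matrix.of (Function.uncurry
      (gramMatrix (X : QubitIdx → MvPolynomial QubitIdx ℂ))).curry = gramMatrix X := rfl
  rw [h3] at h2
  rw [← h2]
  exact h1.eval₂ _ _ (fun _ => isHomogeneous_C _ _) fun _ => isHomogeneous_gramMatrix _ _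

lemma isHomogeneous_det_stateMatrix :
    (stateMatrix (X : QubitIdx → MvPolynomial QubitIdx ℂ)).det.IsHomogeneous 4 := by
  rw [Matrix.det_apply']
  refine IsHomogeneous.sum _ _ _ fun σ _ => ?_
  have h : (∏ i, stateMatrix (X : QubitIdx → MvPolynomial QubitIdx ℂ) (σ i) i).IsHomogeneous
      (∑ _i : Fin 2 × Fin 2, 1) :=
    IsHomogeneous.prod _ _ _ fun i _ => isHomogeneous_X _ _
  have hc : (((Equiv.Perm.sign σ : ℤˣ) : ℤ) : MvPolynomial QubitIdx ℂ).IsHomogeneous 0 := by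
    rw [← map_intCast (C : ℂ →+* MvPolynomial QubitIdx ℂ)]
    exact isHomogeneous_C _ _
  simpa using hc.mul h

lemma isHomogeneous_basicInv (i : Fin 4) :
    (basicInv (X : QubitIdx → MvPolynomial QubitIdx ℂ) i).IsHomogeneous (basicDegree i) := by
  fin_cases i
  · exact (isHomogeneous_coeff_charpoly_gramMatrix (i := 3) (j := 1) rfl).neg
  · exact isHomogeneous_coeff_charpoly_gramMatrix (i := 2) (j := 2) rfl
  · exact (isHomogeneous_coeff_charpoly_gramMatrix (i := 1) (j := 3) rfl).neg
  · exact isHomogeneous_det_stateMatrix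

lemma isHomogeneous_invariantMap_monomial (m : Fin 4 →₀ ℕ) (c : ℂ) :
    (invariantMap (monomial m c)).IsHomogeneous (Finsupp.weight basicDegree m) := by
  rw [invariantMap, aeval_monomial, Finsupp.weight_apply]
  have h : (m.prod fun i k => basicInv (X : QubitIdx → MvPolynomial QubitIdx ℂ) i ^ k).IsHomogeneous
      (∑ i ∈ m.support, basicDegree i * m i) :=
    IsHomogeneous.prod _ _ _ fun i _ => (isHomogeneous_basicInv i).pow _
  have h' := (isHomogeneous_C QubitIdx c).mul h
  rw [zero_add] at h'
  have e : (m.sum fun i k => k • basicDegree i) = ∑ i ∈ m.support, basicDegree i * m i :=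
    Finset.sum_congr rfl fun i _ => mul_comm _ _
  rw [e]
  exact h'

lemma homogeneousComponent_invariantMap (d : ℕ) (q : MvPolynomial (Fin 4) ℂ) :
    homogeneousComponent d (invariantMap q) =
      invariantMap (weightedHomogeneousComponent basicDegree d q) := by
  induction q using MvPolynomial.induction_on' with
  | monomial m c =>
    rw [homogeneousComponent_of_mem (isHomogeneous_invariantMap_monomial m c),
      weightedHomogeneousComponent_of_mem (isWeightedHomogeneous_monomial basicDegree m c rfl)]
    split_ifs <;> simp
  | add p q hp hq => simp only [map_add, hp, hq]

lemma mem_invSpace4_iff {d : ℕ} {f : MvPolynomial QubitIdx ℂ} :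
    f ∈ invSpace4 2 2 2 2 d ↔ f.IsHomogeneous d ∧ IsSLInvariant f := by
  simp [invSpace4, IsSLInvariant, Submodule.mem_iInf, LinearMap.mem_eqLocus]

lemma invSpace4_eq_map (d : ℕ) :
    invSpace4 2 2 2 2 d =
      (weightedHomogeneousSubmodule ℂ basicDegree d).map invariantMap.toLinearMap := by
  ext f
  rw [mem_invSpace4_iff, Submodule.mem_map]
  constructor
  · rintro ⟨hd, hf⟩
    obtain ⟨q, rfl⟩ := mem_range_invariantMap hf
    refine ⟨_, weightedHomogeneousComponent_mem basicDegree q d, ?_⟩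
    rw [AlgHom.toLinearMap_apply, ← homogeneousComponent_invariantMap,
      homogeneousComponent_of_mem hd, if_pos rfl]
  · rintro ⟨q, hq, rfl⟩
    refine ⟨?_, isSLInvariant_invariantMap q⟩
    rw [AlgHom.toLinearMap_apply,
      ← (show IsWeightedHomogeneous basicDegree q d from hq).weightedHomogeneousComponent_same,
      ← homogeneousComponent_invariantMap]
    exact homogeneousComponent_isHomogeneous d _

lemma rank_weightedHomogeneousSubmodule {σ : Type} (w : σ → ℕ) (d : ℕ) :
    Module.rank ℂ (weightedHomogeneousSubmodule ℂ w d) =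
      Cardinal.mk {m : σ →₀ ℕ // Finsupp.weight w m = d} := by
  rw [weightedHomogeneousSubmodule_eq_finsupp_supported]
  rw [(AddMonoidAlgebra.supportedEquivFinsupp (R := ℂ) (S := ℂ)
    {m : σ →₀ ℕ | Finsupp.weight w m = d}).rank_eq, rank_finsupp_self']
  rfl

/-- Exponents of weight `d`, as quadruples. -/
def exponentEquiv (d : ℕ) : {m : Fin 4 →₀ ℕ // Finsupp.weight basicDegree m = d} ≃
    {p : ℕ × ℕ × ℕ × ℕ // 2 * p.1 + 4 * p.2.1 + 4 * p.2.2.1 + 6 * p.2.2.2 = d} where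
  toFun m := ⟨(m.1 0, m.1 1, m.1 3, m.1 2), by
    obtain ⟨m, hm⟩ := m
    simp [Finsupp.weight_apply, Finsupp.sum_fintype, Fin.sum_univ_four, basicDegree] at hm ⊢
    omega⟩
  invFun p := ⟨Finsupp.equivFunOnFinite.symm ![p.1.1, p.1.2.1, p.1.2.2.2, p.1.2.2.1], by
    obtain ⟨p, hp⟩ := p
    simp [Finsupp.weight_apply, Finsupp.sum_fintype, Fin.sum_univ_four, basicDegree] at hp ⊢
    omega⟩
  left_inv m := by
    ext i
    fin_cases i <;> rfl
  right_inv p := rfl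

lemma finite_quadruples (d : ℕ) : Finite {p : ℕ × ℕ × ℕ × ℕ //
    2 * p.1 + 4 * p.2.1 + 4 * p.2.2.1 + 6 * p.2.2.2 = d} := by
  refine (((Set.finite_Iic d).prod ((Set.finite_Iic d).prod ((Set.finite_Iic d).prod
    (Set.finite_Iic d)))).subset ?_).to_subtype
  rintro ⟨a, b, c, e⟩ h
  have h : 2 * a + 4 * b + 4 * c + 6 * e = d := h
  simp only [Set.mem_prod, Set.mem_Iic]
  omega

/-- for the action of `SL₂(ℂ)⁴` on `ℂ[x_{ijkl} : i,j,k,l ∈ {1,2}]`,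
the space of invariant polynomials homogeneous of degree `d` has dimension equal to
the number of quadruples `(a,b,c,e) ∈ ℕ⁴` with `2a + 4b + 4c + 6e = d`
(Kac: the invariant algebra is free on generators of degrees 2, 4, 4, 6; affine
Dynkin diagram `D̂₄`, generating series `1/((1-q)(1-q²)²(1-q³))` for
`g(n²,n²,n²,n²)`). -/
theorem stmt19 (d : ℕ) :
    Module.rank ℂ ↥(invSpace4 2 2 2 2 d) =
      (Nat.card {p : ℕ × ℕ × ℕ × ℕ //
        2 * p.1 + 4 * p.2.1 + 4 * p.2.2.1 + 6 * p.2.2.2 = d} : Cardinal) := by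
  have := finite_quadruples d
  rw [invSpace4_eq_map, ← ((weightedHomogeneousSubmodule ℂ basicDegree d).equivMapOfInjective
      invariantMap.toLinearMap invariantMap_injective).rank_eq,
    rank_weightedHomogeneousSubmodule, Nat.cast_card]
  exact Cardinal.mk_congr (exponentEquiv d)
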